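/- arXiv:1804.02779 — 5 statements merged into one kernel-verified Lean document; each statement's English description precedes it below -/
import Mathlib

section
/- Assume the quasimonotone assumptions hold for ordered upper and lower solutions Ũ, Û of the nonlinear difference scheme. Let Ū⁽¹⁾ be obtained from Ū⁽⁰⁾ = Ũ by one block Jacobi step, and let U̲⁽¹⁾ be obtained from U̲⁽⁰⁾ = Û by one block Jacobi step. Then Ū_α⁽¹⁾(i,j) ≤ Ū_α⁽⁰⁾(i,j) and U̲_α⁽¹⁾(i,j) ≥ U̲_α⁽⁰⁾(i,j) at every mesh point for α = 1,2. -/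
namespace BlockMonotone

/-- A rectangular mesh on the unit square with `Nx, Ny ≥ 2` subdivisions. -/
structure Mesh where
  Nx : ℕ
  Ny : ℕ
  hNx : 2 ≤ Nx
  hNy : 2 ≤ Ny

namespace Mesh

variable (M : Mesh)

/-- Mesh spacing in the x-direction. -/
noncomputable def hx : ℝ := 1 / (M.Nx : ℝ)

/-- Mesh spacing in the y-direction. -/
noncomputable def hy : ℝ := 1 / (M.Ny : ℝ)

/-- `(i,j)` is a mesh point. -/
def IsMeshPt (i j : ℕ) : Prop := i ≤ M.Nx ∧ j ≤ M.Ny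

/-- `(i,j)` is an interior mesh point. -/
def IsInterior (i j : ℕ) : Prop := 1 ≤ i ∧ i ≤ M.Nx - 1 ∧ 1 ≤ j ∧ j ≤ M.Ny - 1

/-- `(i,j)` is a boundary mesh point. -/
def IsBoundary (i j : ℕ) : Prop := M.IsMeshPt i j ∧ ¬ M.IsInterior i j

/-- Coefficient `l_α(i,j) = ε/hx² + v(i,j)/hx`. -/
noncomputable def lC (ε : ℝ) (v : ℕ → ℕ → ℝ) (i j : ℕ) : ℝ := ε / M.hx ^ 2 + v i j / M.hx

/-- Coefficient `r_α(i,j) = ε/hx²`. -/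
noncomputable def rC (ε : ℝ) : ℝ := ε / M.hx ^ 2

/-- Coefficient `b_α(i,j) = ε/hy² + v(i,j)/hy`. -/
noncomputable def bC (ε : ℝ) (v : ℕ → ℕ → ℝ) (i j : ℕ) : ℝ := ε / M.hy ^ 2 + v i j / M.hy

/-- Coefficient `t_α(i,j) = ε/hy²`. -/
noncomputable def tC (ε : ℝ) : ℝ := ε / M.hy ^ 2

/-- Coefficient `d_α(i,j) = l + r + b + t`. -/
noncomputable def dC (ε : ℝ) (v : ℕ → ℕ → ℝ) (i j : ℕ) : ℝ :=
  M.lC ε v i j + M.rC ε + M.bC ε v i j + M.tC ε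

/-- The discrete operator `𝓛 U(i,j)` at interior points. -/
noncomputable def discL (ε : ℝ) (v : ℕ → ℕ → ℝ) (U : ℕ → ℕ → ℝ) (i j : ℕ) : ℝ :=
  M.dC ε v i j * U i j - M.lC ε v i j * U (i - 1) j - M.rC ε * U (i + 1) j
    - M.bC ε v i j * U i (j - 1) - M.tC ε * U i (j + 1)

end Mesh

/-- Partial derivative of a two-variable real function in its first variable. -/
noncomputable def p1 (f : ℝ → ℝ → ℝ) (u₁ u₂ : ℝ) : ℝ := deriv (fun x => f x u₂) u₁

/-- Partial derivative of a two-variable real function in its second variable. -/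
noncomputable def p2 (f : ℝ → ℝ → ℝ) (u₁ u₂ : ℝ) : ℝ := deriv (fun y => f u₁ y) u₂

end BlockMonotone

open BlockMonotone

/-- Discrete minimum principle for a strictly diagonally dominant tridiagonal operator. -/
theorem nonneg_of_tridiagonal {N : ℕ} {D b t Z : ℕ → ℝ} (h0 : 0 ≤ Z 0) (hN : 0 ≤ Z N)
    (hb : ∀ j, 1 ≤ j → j < N → 0 ≤ b j) (ht : ∀ j, 1 ≤ j → j < N → 0 ≤ t j)
    (hD : ∀ j, 1 ≤ j → j < N → b j + t j < D j)
    (hZ : ∀ j, 1 ≤ j → j < N → 0 ≤ D j * Z j - b j * Z (j - 1) - t j * Z (j + 1))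
    {j : ℕ} (hj : j ≤ N) : 0 ≤ Z j := by
  obtain ⟨m, hm, hmin⟩ :=
    Finset.exists_min_image (Finset.range (N + 1)) Z ⟨0, by simp⟩
  have hle : ∀ k ≤ N, Z m ≤ Z k := fun k hk => hmin k (Finset.mem_range.2 (by omega))
  refine le_trans ?_ (hle j hj)
  have hmN : m ≤ N := by simpa [Nat.lt_succ_iff] using hm
  by_cases hm0 : m = 0
  · rwa [hm0]
  by_cases hmN' : m = N
  · rwa [hmN']
  have h1 : 1 ≤ m := by omega
  have h2 : m < N := by omega
  have hleft := mul_le_mul_of_nonneg_left (hle (m - 1) (by omega)) (hb m h1 h2)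
  have hright := mul_le_mul_of_nonneg_left (hle (m + 1) (by omega)) (ht m h1 h2)
  have hmul : 0 ≤ (D m - b m - t m) * Z m := by linarith [hZ m h1 h2]
  exact nonneg_of_mul_nonneg_right hmul (by linarith [hD m h1 h2])

namespace BlockMonotone.Mesh

variable (M : Mesh)

theorem hx_pos : 0 < M.hx := by
  have : (0 : ℝ) < M.Nx := by exact_mod_cast (show 0 < M.Nx by have := M.hNx; omega)
  unfold hx
  positivity

theorem hy_pos : 0 < M.hy := by
  have : (0 : ℝ) < M.Ny := by exact_mod_cast (show 0 < M.Ny by have := M.hNy; omega)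
  unfold hy
  positivity

theorem IsInterior.isMeshPt {M : Mesh} {i j : ℕ} (h : M.IsInterior i j) : M.IsMeshPt i j := by
  unfold IsInterior at h
  unfold IsMeshPt
  omega

/-- Minimum principle for the block operator `d - b - t + c` along the columns of the mesh. -/
theorem nonneg_of_block {ε : ℝ} (hε : 0 < ε) {v c Z : ℕ → ℕ → ℝ}
    (hv : ∀ i j, M.IsMeshPt i j → 0 ≤ v i j) (hc : ∀ i j, M.IsMeshPt i j → 0 ≤ c i j)
    (hbd : ∀ i j, M.IsBoundary i j → 0 ≤ Z i j)
    (hint : ∀ i j, M.IsInterior i j →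
      0 ≤ (M.dC ε v i j + c i j) * Z i j - M.bC ε v i j * Z i (j - 1) - M.tC ε * Z i (j + 1))
    {i j : ℕ} (hij : M.IsMeshPt i j) : 0 ≤ Z i j := by
  by_cases hI : M.IsInterior i j
  · have hx := M.hx_pos
    have hy := M.hy_pos
    have hcol : ∀ k, 1 ≤ k → k < M.Ny → M.IsInterior i k := by
      intro k _ _
      unfold IsInterior at hI ⊢
      omega
    have hedge : ∀ k, k = 0 ∨ k = M.Ny → M.IsBoundary i k := by
      intro k hk
      have := M.hNy
      unfold IsBoundary IsMeshPt IsInterior at *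
      omega
    refine nonneg_of_tridiagonal (Z := Z i) (D := fun k => M.dC ε v i k + c i k)
      (b := M.bC ε v i) (t := fun _ => M.tC ε) (hbd _ _ (hedge 0 (.inl rfl)))
      (hbd _ _ (hedge M.Ny (.inr rfl))) ?_ ?_ ?_ (fun k h1 h2 => hint i k (hcol k h1 h2)) hij.2
    · intro k h1 h2
      have := hv i k (hcol k h1 h2).isMeshPt
      unfold bC
      positivity
    · intro k _ _
      unfold tC
      positivity
    · intro k h1 h2
      have hvk := hv i k (hcol k h1 h2).isMeshPt
      have hck := hc i k (hcol k h1 h2).isMeshPt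
      have hl : 0 < M.lC ε v i k := by unfold lC; positivity
      have hr : 0 < M.rC ε := by unfold rC; positivity
      simp only [dC]
      linarith
  · exact hbd i j ⟨hij, hI⟩

end BlockMonotone.Mesh

/-- One block Jacobi step starting from ordered upper and lower solutions moves the
upper solution down and the lower solution up at every mesh point. -/
theorem jacobi_first_step_monotone (M : Mesh)
    (ε : Fin 2 → ℝ) (hε : ∀ a, 0 < ε a)
    (v : Fin 2 → ℕ → ℕ → ℝ) (hv : ∀ a i j, M.IsMeshPt i j → 0 ≤ v a i j)
    (f : Fin 2 → ℕ → ℕ → ℝ → ℝ → ℝ) (g : Fin 2 → ℕ → ℕ → ℝ)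
    (Utilde Uhat : Fin 2 → ℕ → ℕ → ℝ)
    (c : Fin 2 → ℕ → ℕ → ℝ)
    (hc : ∀ a i j, M.IsMeshPt i j → 0 ≤ c a i j)
    (hdiff1 : ∀ a i j u₂, Differentiable ℝ (fun x => f a i j x u₂))
    (hdiff2 : ∀ a i j u₁, Differentiable ℝ (fun y => f a i j u₁ y))
    (hq1 : ∀ i j, M.IsMeshPt i j → ∀ u₁ u₂,
      Uhat 0 i j ≤ u₁ → u₁ ≤ Utilde 0 i j → Uhat 1 i j ≤ u₂ → u₂ ≤ Utilde 1 i j →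
      p1 (f 0 i j) u₁ u₂ ≤ c 0 i j ∧ p2 (f 1 i j) u₁ u₂ ≤ c 1 i j)
    (hq2 : ∀ i j, M.IsMeshPt i j → ∀ u₁ u₂,
      Uhat 0 i j ≤ u₁ → u₁ ≤ Utilde 0 i j → Uhat 1 i j ≤ u₂ → u₂ ≤ Utilde 1 i j →
      p2 (f 0 i j) u₁ u₂ ≤ 0 ∧ p1 (f 1 i j) u₁ u₂ ≤ 0)
    (hord : ∀ a i j, M.IsMeshPt i j → Uhat a i j ≤ Utilde a i j)
    (hupper : ∀ a i j, M.IsInterior i j →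
      0 ≤ M.discL (ε a) (v a) (Utilde a) i j + f a i j (Utilde 0 i j) (Utilde 1 i j))
    (hlower : ∀ a i j, M.IsInterior i j →
      M.discL (ε a) (v a) (Uhat a) i j + f a i j (Uhat 0 i j) (Uhat 1 i j) ≤ 0)
    (hbd : ∀ a i j, M.IsBoundary i j → Uhat a i j ≤ g a i j ∧ g a i j ≤ Utilde a i j)
    (Ubar1 Ulow1 : Fin 2 → ℕ → ℕ → ℝ)
    (hubstep : ∀ a i j, M.IsInterior i j →
      M.dC (ε a) (v a) i j * Ubar1 a i j - M.bC (ε a) (v a) i j * Ubar1 a i (j - 1)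
          - M.tC (ε a) * Ubar1 a i (j + 1) + c a i j * Ubar1 a i j
        = M.lC (ε a) (v a) i j * Utilde a (i - 1) j + M.rC (ε a) * Utilde a (i + 1) j
          + c a i j * Utilde a i j - f a i j (Utilde 0 i j) (Utilde 1 i j))
    (hubbd : ∀ a i j, M.IsBoundary i j → Ubar1 a i j = g a i j)
    (hlostep : ∀ a i j, M.IsInterior i j →
      M.dC (ε a) (v a) i j * Ulow1 a i j - M.bC (ε a) (v a) i j * Ulow1 a i (j - 1)
          - M.tC (ε a) * Ulow1 a i (j + 1) + c a i j * Ulow1 a i j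
        = M.lC (ε a) (v a) i j * Uhat a (i - 1) j + M.rC (ε a) * Uhat a (i + 1) j
          + c a i j * Uhat a i j - f a i j (Uhat 0 i j) (Uhat 1 i j))
    (hlobd : ∀ a i j, M.IsBoundary i j → Ulow1 a i j = g a i j) :
    ∀ a i j, M.IsMeshPt i j →
      Ubar1 a i j ≤ Utilde a i j ∧ Uhat a i j ≤ Ulow1 a i j := by
  intro a i j hij
  constructor
  · refine sub_nonneg.1 (M.nonneg_of_block (Z := fun i j => Utilde a i j - Ubar1 a i j)
      (hε a) (hv a) (hc a) (fun i j h => ?_) (fun i j h => ?_) hij)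
    · rw [hubbd a i j h]
      exact sub_nonneg.2 (hbd a i j h).2
    · have hu := hupper a i j h
      unfold Mesh.discL at hu
      linarith [hubstep a i j h]
  · refine sub_nonneg.1 (M.nonneg_of_block (Z := fun i j => Ulow1 a i j - Uhat a i j)
      (hε a) (hv a) (hc a) (fun i j h => ?_) (fun i j h => ?_) hij)
    · rw [hlobd a i j h]
      exact sub_nonneg.2 (hbd a i j h).1
    · have hl := hlower a i j h
      unfold Mesh.discL at hl
      linarith [hlostep a i j h]
end

section
/- Assume the quasimonotone assumptions hold for ordered upper and lower solutions Ũ, Û of the nonlinear difference scheme. Let Ū⁽¹⁾ be obtained from Ū⁽⁰⁾ = Ũ by one block Gauss–Seidel step, and let U̲⁽¹⁾ be obtained from U̲⁽⁰⁾ = Û by one block Gauss–Seidel step. Then Ū_α⁽¹⁾(i,j) ≤ Ū_α⁽⁰⁾(i,j) and U̲_α⁽¹⁾(i,j) ≥ U̲_α⁽⁰⁾(i,j) at every mesh point for α = 1,2. -/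
open BlockMonotone

namespace BlockMonotone.Mesh

variable (M : Mesh)

/-- Discrete minimum principle for one block Gauss–Seidel sweep: columns are treated from left
to right, and on each column the operator is strictly diagonally dominant. -/
theorem nonneg_of_blockOperator_nonneg {ε : ℝ} (hε : 0 < ε) {v c W : ℕ → ℕ → ℝ}
    (hv : ∀ i j, M.IsMeshPt i j → 0 ≤ v i j) (hc : ∀ i j, M.IsMeshPt i j → 0 ≤ c i j)
    (hbd : ∀ i j, M.IsBoundary i j → 0 ≤ W i j)
    (hW : ∀ i j, M.IsInterior i j →
      0 ≤ (M.dC ε v i j + c i j) * W i j - M.bC ε v i j * W i (j - 1)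
        - M.tC ε * W i (j + 1) - M.lC ε v i j * W (i - 1) j) :
    ∀ i j, M.IsMeshPt i j → 0 ≤ W i j := by
  have hx := M.hx_pos
  have hy := M.hy_pos
  intro i
  induction i with
  | zero =>
    intro j hj
    exact hbd 0 j ⟨hj, fun h => by simp [IsInterior] at h⟩
  | succ i ih =>
    intro j hj
    obtain ⟨k, hk, hmin⟩ := Finset.exists_min_image (Finset.range (M.Ny + 1)) (W (i + 1))
      ⟨0, by simp⟩
    have hmin' : ∀ m, m ≤ M.Ny → W (i + 1) k ≤ W (i + 1) m := fun m hm =>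
      hmin m (by simpa [Nat.lt_succ_iff] using hm)
    refine le_trans ?_ (hmin' j hj.2)
    have hkm : M.IsMeshPt (i + 1) k := ⟨hj.1, by simpa [Nat.lt_succ_iff] using hk⟩
    by_cases hint : M.IsInterior (i + 1) k
    · by_contra! hneg
      have hstep := hW _ _ hint
      have hk1 : k + 1 ≤ M.Ny := by unfold IsInterior at hint; omega
      have hprev := ih k ⟨by have := hkm.1; omega, hkm.2⟩
      have hvk := hv _ _ hkm
      have hr : 0 < M.rC ε := by unfold rC; positivity
      have ht : 0 ≤ M.tC ε := by unfold tC; positivity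
      have hl : 0 ≤ M.lC ε v (i + 1) k := by unfold lC; positivity
      have hb : 0 ≤ M.bC ε v (i + 1) k := by unfold bC; positivity
      have hbelow := mul_le_mul_of_nonneg_left (hmin' (k - 1) (by omega)) hb
      have habove := mul_le_mul_of_nonneg_left (hmin' (k + 1) hk1) ht
      have hleft := mul_nonneg hl hprev
      have hdiag : (M.lC ε v (i + 1) k + M.rC ε + c (i + 1) k) * W (i + 1) k < 0 :=
        mul_neg_of_pos_of_neg (by linarith [hc _ _ hkm]) hneg
      simp only [dC, Nat.add_sub_cancel] at hstep
      linarith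
    · exact hbd _ _ ⟨hkm, hint⟩

end BlockMonotone.Mesh

/-- One block Gauss–Seidel step starting from ordered upper and lower solutions moves
the upper solution down and the lower solution up at every mesh point. -/
theorem gauss_seidel_first_step_monotone (M : Mesh)
    (ε : Fin 2 → ℝ) (hε : ∀ a, 0 < ε a)
    (v : Fin 2 → ℕ → ℕ → ℝ) (hv : ∀ a i j, M.IsMeshPt i j → 0 ≤ v a i j)
    (f : Fin 2 → ℕ → ℕ → ℝ → ℝ → ℝ) (g : Fin 2 → ℕ → ℕ → ℝ)
    (Utilde Uhat : Fin 2 → ℕ → ℕ → ℝ)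
    (c : Fin 2 → ℕ → ℕ → ℝ)
    (hc : ∀ a i j, M.IsMeshPt i j → 0 ≤ c a i j)
    (hdiff1 : ∀ a i j u₂, Differentiable ℝ (fun x => f a i j x u₂))
    (hdiff2 : ∀ a i j u₁, Differentiable ℝ (fun y => f a i j u₁ y))
    (hq1 : ∀ i j, M.IsMeshPt i j → ∀ u₁ u₂,
      Uhat 0 i j ≤ u₁ → u₁ ≤ Utilde 0 i j → Uhat 1 i j ≤ u₂ → u₂ ≤ Utilde 1 i j →
      p1 (f 0 i j) u₁ u₂ ≤ c 0 i j ∧ p2 (f 1 i j) u₁ u₂ ≤ c 1 i j)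
    (hq2 : ∀ i j, M.IsMeshPt i j → ∀ u₁ u₂,
      Uhat 0 i j ≤ u₁ → u₁ ≤ Utilde 0 i j → Uhat 1 i j ≤ u₂ → u₂ ≤ Utilde 1 i j →
      p2 (f 0 i j) u₁ u₂ ≤ 0 ∧ p1 (f 1 i j) u₁ u₂ ≤ 0)
    (hord : ∀ a i j, M.IsMeshPt i j → Uhat a i j ≤ Utilde a i j)
    (hupper : ∀ a i j, M.IsInterior i j →
      0 ≤ M.discL (ε a) (v a) (Utilde a) i j + f a i j (Utilde 0 i j) (Utilde 1 i j))
    (hlower : ∀ a i j, M.IsInterior i j →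
      M.discL (ε a) (v a) (Uhat a) i j + f a i j (Uhat 0 i j) (Uhat 1 i j) ≤ 0)
    (hbd : ∀ a i j, M.IsBoundary i j → Uhat a i j ≤ g a i j ∧ g a i j ≤ Utilde a i j)
    (Ubar1 Ulow1 : Fin 2 → ℕ → ℕ → ℝ)
    (hubstep : ∀ a i j, M.IsInterior i j →
      M.dC (ε a) (v a) i j * Ubar1 a i j - M.bC (ε a) (v a) i j * Ubar1 a i (j - 1)
          - M.tC (ε a) * Ubar1 a i (j + 1) - M.lC (ε a) (v a) i j * Ubar1 a (i - 1) j
          + c a i j * Ubar1 a i j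
        = M.rC (ε a) * Utilde a (i + 1) j
          + c a i j * Utilde a i j - f a i j (Utilde 0 i j) (Utilde 1 i j))
    (hubbd : ∀ a i j, M.IsBoundary i j → Ubar1 a i j = g a i j)
    (hlostep : ∀ a i j, M.IsInterior i j →
      M.dC (ε a) (v a) i j * Ulow1 a i j - M.bC (ε a) (v a) i j * Ulow1 a i (j - 1)
          - M.tC (ε a) * Ulow1 a i (j + 1) - M.lC (ε a) (v a) i j * Ulow1 a (i - 1) j
          + c a i j * Ulow1 a i j
        = M.rC (ε a) * Uhat a (i + 1) j
          + c a i j * Uhat a i j - f a i j (Uhat 0 i j) (Uhat 1 i j))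
    (hlobd : ∀ a i j, M.IsBoundary i j → Ulow1 a i j = g a i j) :
    ∀ a i j, M.IsMeshPt i j →
      Ubar1 a i j ≤ Utilde a i j ∧ Uhat a i j ≤ Ulow1 a i j := by
  intro a i j hij
  constructor
  · refine sub_nonneg.mp (M.nonneg_of_blockOperator_nonneg (hε a) (hv a) (hc a)
      (W := fun i j => Utilde a i j - Ubar1 a i j) ?_ ?_ i j hij)
    · intro i j h
      have := (hbd a i j h).2
      have := hubbd a i j h
      linarith
    · intro i j h
      have hU := hupper a i j h
      have hstep := hubstep a i j h
      unfold Mesh.discL at hU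
      linarith
  · refine sub_nonneg.mp (M.nonneg_of_blockOperator_nonneg (hε a) (hv a) (hc a)
      (W := fun i j => Ulow1 a i j - Uhat a i j) ?_ ?_ i j hij)
    · intro i j h
      have := (hbd a i j h).1
      have := hlobd a i j h
      linarith
    · intro i j h
      have hU := hlower a i j h
      have hstep := hlostep a i j h
      unfold Mesh.discL at hU
      linarith
end

section
/- Assume the quasimonotone assumptions hold for ordered upper and lower solutions Ũ, Û of the nonlinear difference scheme. Let Ū⁽¹⁾ be obtained from Ū⁽⁰⁾ = Ũ by one block Gauss–Seidel step, and let U̲⁽¹⁾ be obtained from U̲⁽⁰⁾ = Û by one block Gauss–Seidel step. Then Ū⁽¹⁾ and U̲⁽¹⁾ are again ordered upper and lower solutions of the nonlinear difference scheme; in particular U̲_α⁽¹⁾ ≤ Ū_α⁽¹⁾ at every mesh point, 𝓛_α Ū_α⁽¹⁾ + f_α(i,j,Ū₁⁽¹⁾,Ū₂⁽¹⁾) ≥ 0 and 𝓛_α U̲_α⁽¹⁾ + f_α(i,j,U̲₁⁽¹⁾,U̲₂⁽¹⁾) ≤ 0 at every interior point, for α = 1,2. -/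
open BlockMonotone

namespace BlockMonotone

/-- Discrete minimum principle for the block Gauss–Seidel operator: a zeroth-order coefficient
that strictly dominates the off-diagonal ones forces nonnegativity from the boundary inwards. -/
theorem Mesh.nonneg_of_gaussSeidel_nonneg (M : Mesh) {ε : ℝ} (hε : 0 < ε) {v c W : ℕ → ℕ → ℝ}
    (hv : ∀ i j, M.IsMeshPt i j → 0 ≤ v i j) (hc : ∀ i j, M.IsMeshPt i j → 0 ≤ c i j)
    (hW : ∀ i j, M.IsInterior i j →
      0 ≤ M.dC ε v i j * W i j - M.bC ε v i j * W i (j - 1) - M.tC ε * W i (j + 1)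
        - M.lC ε v i j * W (i - 1) j + c i j * W i j)
    (hbd : ∀ i j, M.IsBoundary i j → 0 ≤ W i j) {i j : ℕ} (hij : M.IsMeshPt i j) :
    0 ≤ W i j := by
  obtain ⟨⟨p, q⟩, hpq, hmin⟩ := Finset.exists_min_image
    (Finset.range (M.Nx + 1) ×ˢ Finset.range (M.Ny + 1)) (fun x => W x.1 x.2) ⟨(0, 0), by simp⟩
  have hle : ∀ i j, M.IsMeshPt i j → W p q ≤ W i j := fun i j h =>
    hmin (i, j) (by simpa [Mesh.IsMeshPt, Nat.lt_succ_iff] using h)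
  have hmesh : M.IsMeshPt p q := by
    simp only [Finset.mem_product, Finset.mem_range] at hpq
    exact ⟨by omega, by omega⟩
  refine le_trans ?_ (hle i j hij)
  by_cases hin : M.IsInterior p q
  · by_contra! hneg
    have hx : 0 < M.hx := by
      have : 0 < M.Nx := by have := M.hNx; omega
      unfold Mesh.hx; positivity
    have hy : 0 < M.hy := by
      have : 0 < M.Ny := by have := M.hNy; omega
      unfold Mesh.hy; positivity
    have hvpq := hv p q hmesh
    have hl : 0 ≤ M.lC ε v p q := by unfold Mesh.lC; positivity
    have hb : 0 ≤ M.bC ε v p q := by unfold Mesh.bC; positivity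
    have ht : 0 ≤ M.tC ε := by unfold Mesh.tC; positivity
    have hr : 0 < M.rC ε := by unfold Mesh.rC; positivity
    have hstep := hW p q hin
    obtain ⟨h1, h2, h3, h4⟩ := hin
    have hleft := mul_le_mul_of_nonneg_left (hle (p - 1) q ⟨by omega, by omega⟩) hl
    have hbot := mul_le_mul_of_nonneg_left (hle p (q - 1) ⟨by omega, by omega⟩) hb
    have htop := mul_le_mul_of_nonneg_left (hle p (q + 1) ⟨by omega, by omega⟩) ht
    have hcW := mul_nonpos_of_nonneg_of_nonpos (hc p q hmesh) hneg.le
    have hrW := mul_neg_of_pos_of_neg hr hneg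
    rw [Mesh.dC] at hstep
    linarith
  · exact hbd p q ⟨hmesh, hin⟩

theorem sub_le_mul_sub_of_deriv_le_Icc {φ : ℝ → ℝ} (hφ : Differentiable ℝ φ) {x y C : ℝ}
    (hxy : x ≤ y) (h : ∀ z, x ≤ z → z ≤ y → deriv φ z ≤ C) : φ y - φ x ≤ C * (y - x) :=
  (convex_Icc x y).image_sub_le_mul_sub_of_deriv_le hφ.continuous.continuousOn
    hφ.differentiableOn
    (fun z hz => h z (interior_subset hz).1 (interior_subset hz).2)
    x ⟨le_rfl, hxy⟩ y ⟨hxy, le_rfl⟩ hxy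

/-- One-sided Lipschitz bound for a function of two variables that is antitone in the second. -/
theorem sub_le_mul_sub_of_partials_le {F : ℝ → ℝ → ℝ}
    (h1 : ∀ y, Differentiable ℝ (fun x => F x y)) (h2 : ∀ x, Differentiable ℝ (F x))
    {x x' y y' C : ℝ} (hx : x ≤ x') (hy : y ≤ y')
    (hd1 : ∀ z w, x ≤ z → z ≤ x' → y ≤ w → w ≤ y' → deriv (fun s => F s w) z ≤ C)
    (hd2 : ∀ z w, x ≤ z → z ≤ x' → y ≤ w → w ≤ y' → deriv (F z) w ≤ 0) :
    F x' y' - F x y ≤ C * (x' - x) := by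
  have hfst := sub_le_mul_sub_of_deriv_le_Icc (h1 y) hx
    fun z hz hz' => hd1 z y hz hz' le_rfl hy
  have hsnd := sub_le_mul_sub_of_deriv_le_Icc (h2 x') hy
    fun w hw hw' => hd2 x' w hx le_rfl hw hw'
  linarith

end BlockMonotone

/-- After one block Gauss–Seidel step the iterates are again ordered upper and lower
solutions of the nonlinear difference scheme. -/
theorem gauss_seidel_first_step_upper_lower (M : Mesh)
    (ε : Fin 2 → ℝ) (hε : ∀ a, 0 < ε a)
    (v : Fin 2 → ℕ → ℕ → ℝ) (hv : ∀ a i j, M.IsMeshPt i j → 0 ≤ v a i j)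
    (f : Fin 2 → ℕ → ℕ → ℝ → ℝ → ℝ) (g : Fin 2 → ℕ → ℕ → ℝ)
    (Utilde Uhat : Fin 2 → ℕ → ℕ → ℝ)
    (c : Fin 2 → ℕ → ℕ → ℝ)
    (hc : ∀ a i j, M.IsMeshPt i j → 0 ≤ c a i j)
    (hdiff1 : ∀ a i j u₂, Differentiable ℝ (fun x => f a i j x u₂))
    (hdiff2 : ∀ a i j u₁, Differentiable ℝ (fun y => f a i j u₁ y))
    (hq1 : ∀ i j, M.IsMeshPt i j → ∀ u₁ u₂,
      Uhat 0 i j ≤ u₁ → u₁ ≤ Utilde 0 i j → Uhat 1 i j ≤ u₂ → u₂ ≤ Utilde 1 i j →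
      p1 (f 0 i j) u₁ u₂ ≤ c 0 i j ∧ p2 (f 1 i j) u₁ u₂ ≤ c 1 i j)
    (hq2 : ∀ i j, M.IsMeshPt i j → ∀ u₁ u₂,
      Uhat 0 i j ≤ u₁ → u₁ ≤ Utilde 0 i j → Uhat 1 i j ≤ u₂ → u₂ ≤ Utilde 1 i j →
      p2 (f 0 i j) u₁ u₂ ≤ 0 ∧ p1 (f 1 i j) u₁ u₂ ≤ 0)
    (hord : ∀ a i j, M.IsMeshPt i j → Uhat a i j ≤ Utilde a i j)
    (hupper : ∀ a i j, M.IsInterior i j →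
      0 ≤ M.discL (ε a) (v a) (Utilde a) i j + f a i j (Utilde 0 i j) (Utilde 1 i j))
    (hlower : ∀ a i j, M.IsInterior i j →
      M.discL (ε a) (v a) (Uhat a) i j + f a i j (Uhat 0 i j) (Uhat 1 i j) ≤ 0)
    (hbd : ∀ a i j, M.IsBoundary i j → Uhat a i j ≤ g a i j ∧ g a i j ≤ Utilde a i j)
    (Ubar1 Ulow1 : Fin 2 → ℕ → ℕ → ℝ)
    (hubstep : ∀ a i j, M.IsInterior i j →
      M.dC (ε a) (v a) i j * Ubar1 a i j - M.bC (ε a) (v a) i j * Ubar1 a i (j - 1)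
          - M.tC (ε a) * Ubar1 a i (j + 1) - M.lC (ε a) (v a) i j * Ubar1 a (i - 1) j
          + c a i j * Ubar1 a i j
        = M.rC (ε a) * Utilde a (i + 1) j
          + c a i j * Utilde a i j - f a i j (Utilde 0 i j) (Utilde 1 i j))
    (hubbd : ∀ a i j, M.IsBoundary i j → Ubar1 a i j = g a i j)
    (hlostep : ∀ a i j, M.IsInterior i j →
      M.dC (ε a) (v a) i j * Ulow1 a i j - M.bC (ε a) (v a) i j * Ulow1 a i (j - 1)
          - M.tC (ε a) * Ulow1 a i (j + 1) - M.lC (ε a) (v a) i j * Ulow1 a (i - 1) j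
          + c a i j * Ulow1 a i j
        = M.rC (ε a) * Uhat a (i + 1) j
          + c a i j * Uhat a i j - f a i j (Uhat 0 i j) (Uhat 1 i j))
    (hlobd : ∀ a i j, M.IsBoundary i j → Ulow1 a i j = g a i j) :
    (∀ a i j, M.IsMeshPt i j → Ulow1 a i j ≤ Ubar1 a i j)
    ∧ (∀ a i j, M.IsInterior i j →
        0 ≤ M.discL (ε a) (v a) (Ubar1 a) i j + f a i j (Ubar1 0 i j) (Ubar1 1 i j))
    ∧ (∀ a i j, M.IsInterior i j →
        M.discL (ε a) (v a) (Ulow1 a) i j + f a i j (Ulow1 0 i j) (Ulow1 1 i j) ≤ 0)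
    ∧ (∀ a i j, M.IsBoundary i j → Ulow1 a i j ≤ g a i j ∧ g a i j ≤ Ubar1 a i j) := by
  have hmesh : ∀ {i j}, M.IsInterior i j → M.IsMeshPt i j := fun ⟨_, _, _, _⟩ =>
    ⟨by omega, by omega⟩
  have hmesh' : ∀ {i j}, M.IsInterior i j → M.IsMeshPt (i + 1) j := fun ⟨_, _, _, _⟩ =>
    ⟨by omega, by omega⟩
  have hr : ∀ a, 0 ≤ M.rC (ε a) := fun a => by
    have := hε a
    unfold Mesh.rC; positivity
  have hlip : ∀ a i j, M.IsMeshPt i j → ∀ u w : Fin 2 → ℝ,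
      (∀ b, Uhat b i j ≤ u b) → (∀ b, u b ≤ w b) → (∀ b, w b ≤ Utilde b i j) →
      f a i j (w 0) (w 1) - f a i j (u 0) (u 1) ≤ c a i j * (w a - u a) := by
    intro a i j hij u w hu huw hw
    fin_cases a
    · exact sub_le_mul_sub_of_partials_le (hdiff1 0 i j) (hdiff2 0 i j) (huw 0) (huw 1)
        (fun z y hz hz' hy hy' => (hq1 i j hij z y ((hu 0).trans hz) (hz'.trans (hw 0))
          ((hu 1).trans hy) (hy'.trans (hw 1))).1)
        (fun z y hz hz' hy hy' => (hq2 i j hij z y ((hu 0).trans hz) (hz'.trans (hw 0))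
          ((hu 1).trans hy) (hy'.trans (hw 1))).1)
    · exact sub_le_mul_sub_of_partials_le (F := fun y x => f 1 i j x y)
        (hdiff2 1 i j) (hdiff1 1 i j) (huw 1) (huw 0)
        (fun y z hy hy' hz hz' => (hq1 i j hij z y ((hu 0).trans hz) (hz'.trans (hw 0))
          ((hu 1).trans hy) (hy'.trans (hw 1))).2)
        (fun y z hy hy' hz hz' => (hq2 i j hij z y ((hu 0).trans hz) (hz'.trans (hw 0))
          ((hu 1).trans hy) (hy'.trans (hw 1))).2)
  have hbar : ∀ a i j, M.IsMeshPt i j → Ubar1 a i j ≤ Utilde a i j := by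
    intro a i j hij
    refine sub_nonneg.1 (M.nonneg_of_gaussSeidel_nonneg (hε a) (hv a) (hc a)
      (W := fun i j => Utilde a i j - Ubar1 a i j) ?_ ?_ hij)
    · intro i j h
      have h1 := hupper a i j h
      have h2 := hubstep a i j h
      rw [Mesh.discL] at h1
      linarith
    · intro i j h
      rw [hubbd a i j h]
      exact sub_nonneg.2 (hbd a i j h).2
  have hlow : ∀ a i j, M.IsMeshPt i j → Uhat a i j ≤ Ulow1 a i j := by
    intro a i j hij
    refine sub_nonneg.1 (M.nonneg_of_gaussSeidel_nonneg (hε a) (hv a) (hc a)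
      (W := fun i j => Ulow1 a i j - Uhat a i j) ?_ ?_ hij)
    · intro i j h
      have h1 := hlower a i j h
      have h2 := hlostep a i j h
      rw [Mesh.discL] at h1
      linarith
    · intro i j h
      rw [hlobd a i j h]
      exact sub_nonneg.2 (hbd a i j h).1
  have hle : ∀ a i j, M.IsMeshPt i j → Ulow1 a i j ≤ Ubar1 a i j := by
    intro a i j hij
    refine sub_nonneg.1 (M.nonneg_of_gaussSeidel_nonneg (hε a) (hv a) (hc a)
      (W := fun i j => Ubar1 a i j - Ulow1 a i j) ?_ ?_ hij)
    · intro i j h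
      have h1 := hubstep a i j h
      have h2 := hlostep a i j h
      have h3 := hlip a i j (hmesh h) (fun b => Uhat b i j) (fun b => Utilde b i j)
        (fun _ => le_rfl) (fun b => hord b i j (hmesh h)) (fun _ => le_rfl)
      have h4 := mul_le_mul_of_nonneg_left (hord a (i + 1) j (hmesh' h)) (hr a)
      linarith
    · intro i j h
      rw [hubbd a i j h, hlobd a i j h, sub_self]
  refine ⟨hle, ?_, ?_, fun a i j h => ⟨(hlobd a i j h).le, (hubbd a i j h).ge⟩⟩
  · intro a i j h
    have hm := hmesh h
    have h1 := hubstep a i j h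
    have h2 := hlip a i j hm (fun b => Ubar1 b i j) (fun b => Utilde b i j)
      (fun b => (hlow b i j hm).trans (hle b i j hm)) (fun b => hbar b i j hm) (fun _ => le_rfl)
    have h3 := mul_le_mul_of_nonneg_left (hbar a (i + 1) j (hmesh' h)) (hr a)
    rw [Mesh.discL]
    linarith
  · intro a i j h
    have hm := hmesh h
    have h1 := hlostep a i j h
    have h2 := hlip a i j hm (fun b => Uhat b i j) (fun b => Ulow1 b i j)
      (fun _ => le_rfl) (fun b => hlow b i j hm) (fun b => (hle b i j hm).trans (hbar b i j hm))
    have h3 := mul_le_mul_of_nonneg_left (hlow a (i + 1) j (hmesh' h)) (hr a)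
    rw [Mesh.discL]
    linarith
end

section
/- (Comparison of block Jacobi and block Gauss–Seidel.) Assume the quasimonotone assumptions hold for ordered upper and lower solutions Ũ, Û of the nonlinear difference scheme. Let {(Ū⁽ⁿ⁾)_J, (U̲⁽ⁿ⁾)_J} be the sequences generated by the block Jacobi iteration and {(Ū⁽ⁿ⁾)_GS, (U̲⁽ⁿ⁾)_GS} the sequences generated by the block Gauss–Seidel iteration, all starting from (Ū⁽⁰⁾)_J = (Ū⁽⁰⁾)_GS = Ũ and (U̲⁽⁰⁾)_J = (U̲⁽⁰⁾)_GS = Û. Then for every n ≥ 0, every mesh point and α = 1,2: (U̲_α⁽ⁿ⁾)_J ≤ (U̲_α⁽ⁿ⁾)_GS ≤ (Ū_α⁽ⁿ⁾)_GS ≤ (Ū_α⁽ⁿ⁾)_J. -/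
open BlockMonotone

namespace BlockMonotone

/-- A function whose derivative is at most `C` on `[x, y]` grows by at most `C * (y - x)`. -/
theorem sub_le_mul_sub_of_deriv_le {φ : ℝ → ℝ} (hφ : Differentiable ℝ φ) {C x y : ℝ}
    (hxy : x ≤ y) (hC : ∀ z, x ≤ z → z ≤ y → deriv φ z ≤ C) : φ y - φ x ≤ C * (y - x) :=
  (convex_Icc x y).image_sub_le_mul_sub_of_deriv_le hφ.continuous.continuousOn
    hφ.differentiableOn
    (fun z hz => hC z (interior_subset hz).1 (interior_subset hz).2)
    x (Set.left_mem_Icc.2 hxy) y (Set.right_mem_Icc.2 hxy) hxy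

namespace Mesh

variable (M : Mesh)

theorem IsInterior.neighbours {M : Mesh} {i j : ℕ} (h : M.IsInterior i j) :
    M.IsMeshPt (i - 1) j ∧ M.IsMeshPt (i + 1) j ∧ M.IsMeshPt i (j - 1) ∧
      M.IsMeshPt i (j + 1) := by
  unfold IsInterior at h
  unfold IsMeshPt
  omega

variable {M} {ε : ℝ} {v : ℕ → ℕ → ℝ}

theorem rC_pos (hε : 0 < ε) : 0 < M.rC ε := div_pos hε (pow_pos M.hx_pos 2)

theorem tC_pos (hε : 0 < ε) : 0 < M.tC ε := div_pos hε (pow_pos M.hy_pos 2)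

theorem lC_pos (hε : 0 < ε) {i j : ℕ} (hv : 0 ≤ v i j) : 0 < M.lC ε v i j :=
  add_pos_of_pos_of_nonneg (rC_pos hε) (div_nonneg hv M.hx_pos.le)

theorem bC_pos (hε : 0 < ε) {i j : ℕ} (hv : 0 ≤ v i j) : 0 < M.bC ε v i j :=
  add_pos_of_pos_of_nonneg (tC_pos hε) (div_nonneg hv M.hy_pos.le)

/-- Maximum principle for strictly diagonally dominant three-neighbour operators. -/
theorem nonneg_of_dominant {p b t l W : ℕ → ℕ → ℝ}
    (hb : ∀ i j, M.IsInterior i j → 0 ≤ b i j) (ht : ∀ i j, M.IsInterior i j → 0 ≤ t i j)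
    (hl : ∀ i j, M.IsInterior i j → 0 ≤ l i j)
    (hp : ∀ i j, M.IsInterior i j → b i j + t i j + l i j < p i j)
    (hW : ∀ i j, M.IsInterior i j →
      b i j * W i (j - 1) + t i j * W i (j + 1) + l i j * W (i - 1) j ≤ p i j * W i j)
    (hbd : ∀ i j, M.IsBoundary i j → 0 ≤ W i j) :
    ∀ i j, M.IsMeshPt i j → 0 ≤ W i j := by
  obtain ⟨⟨i₀, j₀⟩, hmem, hmin⟩ := Finset.exists_min_image
    (Finset.Iic M.Nx ×ˢ Finset.Iic M.Ny) (fun q => W q.1 q.2) ⟨(0, 0), by simp⟩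
  simp only [Finset.mem_product, Finset.mem_Iic] at hmem
  have hle : ∀ i j, M.IsMeshPt i j → W i₀ j₀ ≤ W i j := fun i j h =>
    hmin (i, j) (by simpa [IsMeshPt] using h)
  suffices h : 0 ≤ W i₀ j₀ from fun i j hij => h.trans (hle i j hij)
  by_cases hI : M.IsInterior i₀ j₀
  · obtain ⟨hw, -, hs, hn⟩ := hI.neighbours
    have h1 := mul_le_mul_of_nonneg_left (hle _ _ hs) (hb _ _ hI)
    have h2 := mul_le_mul_of_nonneg_left (hle _ _ hn) (ht _ _ hI)
    have h3 := mul_le_mul_of_nonneg_left (hle _ _ hw) (hl _ _ hI)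
    have h4 := hW _ _ hI
    refine nonneg_of_mul_nonneg_right (a := p i₀ j₀ - (b i₀ j₀ + t i₀ j₀ + l i₀ j₀)) ?_
      (sub_pos.2 (hp _ _ hI))
    linarith
  · exact hbd _ _ ⟨hmem, hI⟩

variable {c U V : ℕ → ℕ → ℝ}

/-- Comparison principle for the operator inverted by the block Gauss–Seidel iteration. -/
theorem gaussSeidel_comparison (hε : 0 < ε) (hv : ∀ i j, M.IsMeshPt i j → 0 ≤ v i j)
    (hc : ∀ i j, M.IsMeshPt i j → 0 ≤ c i j)
    (hUV : ∀ i j, M.IsInterior i j →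
      M.dC ε v i j * U i j - M.bC ε v i j * U i (j - 1) - M.tC ε * U i (j + 1)
          - M.lC ε v i j * U (i - 1) j + c i j * U i j
        ≤ M.dC ε v i j * V i j - M.bC ε v i j * V i (j - 1) - M.tC ε * V i (j + 1)
          - M.lC ε v i j * V (i - 1) j + c i j * V i j)
    (hbd : ∀ i j, M.IsBoundary i j → U i j ≤ V i j) :
    ∀ i j, M.IsMeshPt i j → U i j ≤ V i j := by
  intro i j hij
  refine sub_nonneg.1 (nonneg_of_dominant (M := M) (p := fun i j => M.dC ε v i j + c i j)
    (b := M.bC ε v) (t := fun _ _ => M.tC ε) (l := M.lC ε v) (W := fun i j => V i j - U i j)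
    (fun i j h => (bC_pos hε (hv i j h.isMeshPt)).le) (fun _ _ _ => (tC_pos hε).le)
    (fun i j h => (lC_pos hε (hv i j h.isMeshPt)).le) (fun i j h => ?_) (fun i j h => ?_)
    (fun i j h => sub_nonneg.2 (hbd i j h)) i j hij)
  · have := hc i j h.isMeshPt
    have := rC_pos (M := M) hε
    simp only [dC]
    linarith
  · have := hUV i j h
    linarith

/-- Comparison principle for the operator inverted by the block Jacobi iteration. -/
theorem jacobi_comparison (hε : 0 < ε) (hv : ∀ i j, M.IsMeshPt i j → 0 ≤ v i j)
    (hc : ∀ i j, M.IsMeshPt i j → 0 ≤ c i j)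
    (hUV : ∀ i j, M.IsInterior i j →
      M.dC ε v i j * U i j - M.bC ε v i j * U i (j - 1) - M.tC ε * U i (j + 1) + c i j * U i j
        ≤ M.dC ε v i j * V i j - M.bC ε v i j * V i (j - 1) - M.tC ε * V i (j + 1)
          + c i j * V i j)
    (hbd : ∀ i j, M.IsBoundary i j → U i j ≤ V i j) :
    ∀ i j, M.IsMeshPt i j → U i j ≤ V i j := by
  intro i j hij
  refine sub_nonneg.1 (nonneg_of_dominant (M := M) (p := fun i j => M.dC ε v i j + c i j)
    (b := M.bC ε v) (t := fun _ _ => M.tC ε) (l := fun _ _ => 0) (W := fun i j => V i j - U i j)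
    (fun i j h => (bC_pos hε (hv i j h.isMeshPt)).le) (fun _ _ _ => (tC_pos hε).le)
    (fun _ _ _ => le_rfl) (fun i j h => ?_) (fun i j h => ?_)
    (fun i j h => sub_nonneg.2 (hbd i j h)) i j hij)
  · have := hc i j h.isMeshPt
    have := rC_pos (M := M) hε
    have := lC_pos (M := M) hε (hv i j h.isMeshPt)
    simp only [dC]
    linarith
  · have := hUV i j h
    linarith

end Mesh

end BlockMonotone

/-- Comparison of the block monotone Jacobi and block monotone Gauss–Seidel methods:
the Gauss–Seidel sequences lie between the Jacobi sequences. -/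
theorem jacobi_gauss_seidel_comparison (M : Mesh)
    (ε : Fin 2 → ℝ) (hε : ∀ a, 0 < ε a)
    (v : Fin 2 → ℕ → ℕ → ℝ) (hv : ∀ a i j, M.IsMeshPt i j → 0 ≤ v a i j)
    (f : Fin 2 → ℕ → ℕ → ℝ → ℝ → ℝ) (g : Fin 2 → ℕ → ℕ → ℝ)
    (Utilde Uhat : Fin 2 → ℕ → ℕ → ℝ)
    (c : Fin 2 → ℕ → ℕ → ℝ)
    (hc : ∀ a i j, M.IsMeshPt i j → 0 ≤ c a i j)
    (hdiff1 : ∀ a i j u₂, Differentiable ℝ (fun x => f a i j x u₂))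
    (hdiff2 : ∀ a i j u₁, Differentiable ℝ (fun y => f a i j u₁ y))
    (hq1 : ∀ i j, M.IsMeshPt i j → ∀ u₁ u₂,
      Uhat 0 i j ≤ u₁ → u₁ ≤ Utilde 0 i j → Uhat 1 i j ≤ u₂ → u₂ ≤ Utilde 1 i j →
      p1 (f 0 i j) u₁ u₂ ≤ c 0 i j ∧ p2 (f 1 i j) u₁ u₂ ≤ c 1 i j)
    (hq2 : ∀ i j, M.IsMeshPt i j → ∀ u₁ u₂,
      Uhat 0 i j ≤ u₁ → u₁ ≤ Utilde 0 i j → Uhat 1 i j ≤ u₂ → u₂ ≤ Utilde 1 i j →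
      p2 (f 0 i j) u₁ u₂ ≤ 0 ∧ p1 (f 1 i j) u₁ u₂ ≤ 0)
    (hord : ∀ a i j, M.IsMeshPt i j → Uhat a i j ≤ Utilde a i j)
    (hupper : ∀ a i j, M.IsInterior i j →
      0 ≤ M.discL (ε a) (v a) (Utilde a) i j + f a i j (Utilde 0 i j) (Utilde 1 i j))
    (hlower : ∀ a i j, M.IsInterior i j →
      M.discL (ε a) (v a) (Uhat a) i j + f a i j (Uhat 0 i j) (Uhat 1 i j) ≤ 0)
    (hbd : ∀ a i j, M.IsBoundary i j → Uhat a i j ≤ g a i j ∧ g a i j ≤ Utilde a i j)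
    (UbJ UlJ UbGS UlGS : ℕ → Fin 2 → ℕ → ℕ → ℝ)
    (hUbJ0 : ∀ a i j, UbJ 0 a i j = Utilde a i j)
    (hUlJ0 : ∀ a i j, UlJ 0 a i j = Uhat a i j)
    (hUbGS0 : ∀ a i j, UbGS 0 a i j = Utilde a i j)
    (hUlGS0 : ∀ a i j, UlGS 0 a i j = Uhat a i j)
    (hubJstep : ∀ n, 1 ≤ n → ∀ a i j, M.IsInterior i j →
      M.dC (ε a) (v a) i j * UbJ n a i j - M.bC (ε a) (v a) i j * UbJ n a i (j - 1)
          - M.tC (ε a) * UbJ n a i (j + 1) + c a i j * UbJ n a i j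
        = M.lC (ε a) (v a) i j * UbJ (n - 1) a (i - 1) j + M.rC (ε a) * UbJ (n - 1) a (i + 1) j
          + c a i j * UbJ (n - 1) a i j
          - f a i j (UbJ (n - 1) 0 i j) (UbJ (n - 1) 1 i j))
    (hubJbd : ∀ n, 1 ≤ n → ∀ a i j, M.IsBoundary i j → UbJ n a i j = g a i j)
    (hloJstep : ∀ n, 1 ≤ n → ∀ a i j, M.IsInterior i j →
      M.dC (ε a) (v a) i j * UlJ n a i j - M.bC (ε a) (v a) i j * UlJ n a i (j - 1)
          - M.tC (ε a) * UlJ n a i (j + 1) + c a i j * UlJ n a i j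
        = M.lC (ε a) (v a) i j * UlJ (n - 1) a (i - 1) j + M.rC (ε a) * UlJ (n - 1) a (i + 1) j
          + c a i j * UlJ (n - 1) a i j
          - f a i j (UlJ (n - 1) 0 i j) (UlJ (n - 1) 1 i j))
    (hloJbd : ∀ n, 1 ≤ n → ∀ a i j, M.IsBoundary i j → UlJ n a i j = g a i j)
    (hubGSstep : ∀ n, 1 ≤ n → ∀ a i j, M.IsInterior i j →
      M.dC (ε a) (v a) i j * UbGS n a i j - M.bC (ε a) (v a) i j * UbGS n a i (j - 1)
          - M.tC (ε a) * UbGS n a i (j + 1) - M.lC (ε a) (v a) i j * UbGS n a (i - 1) j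
          + c a i j * UbGS n a i j
        = M.rC (ε a) * UbGS (n - 1) a (i + 1) j + c a i j * UbGS (n - 1) a i j
          - f a i j (UbGS (n - 1) 0 i j) (UbGS (n - 1) 1 i j))
    (hubGSbd : ∀ n, 1 ≤ n → ∀ a i j, M.IsBoundary i j → UbGS n a i j = g a i j)
    (hloGSstep : ∀ n, 1 ≤ n → ∀ a i j, M.IsInterior i j →
      M.dC (ε a) (v a) i j * UlGS n a i j - M.bC (ε a) (v a) i j * UlGS n a i (j - 1)
          - M.tC (ε a) * UlGS n a i (j + 1) - M.lC (ε a) (v a) i j * UlGS n a (i - 1) j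
          + c a i j * UlGS n a i j
        = M.rC (ε a) * UlGS (n - 1) a (i + 1) j + c a i j * UlGS (n - 1) a i j
          - f a i j (UlGS (n - 1) 0 i j) (UlGS (n - 1) 1 i j))
    (hloGSbd : ∀ n, 1 ≤ n → ∀ a i j, M.IsBoundary i j → UlGS n a i j = g a i j) :
    ∀ n a i j, M.IsMeshPt i j →
      UlJ n a i j ≤ UlGS n a i j ∧ UlGS n a i j ≤ UbGS n a i j
        ∧ UbGS n a i j ≤ UbJ n a i j := by
  have hF : ∀ i j, M.IsMeshPt i j → ∀ u w : Fin 2 → ℝ, (∀ a, Uhat a i j ≤ u a) →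
      (∀ a, u a ≤ w a) → (∀ a, w a ≤ Utilde a i j) →
      ∀ a, c a i j * u a - f a i j (u 0) (u 1) ≤ c a i j * w a - f a i j (w 0) (w 1) := by
    intro i j hij u w hu huw hw
    rw [Fin.forall_fin_two] at hu huw hw ⊢
    constructor
    · have h1 := sub_le_mul_sub_of_deriv_le (hdiff1 0 i j (w 1)) huw.1 fun z h h' =>
        (hq1 i j hij z (w 1) (hu.1.trans h) (h'.trans hw.1) (hu.2.trans huw.2) hw.2).1
      have h2 := sub_le_mul_sub_of_deriv_le (hdiff2 0 i j (u 0)) huw.2 fun z h h' =>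
        (hq2 i j hij (u 0) z hu.1 (huw.1.trans hw.1) (hu.2.trans h) (h'.trans hw.2)).1
      linarith
    · have h1 := sub_le_mul_sub_of_deriv_le (hdiff2 1 i j (w 0)) huw.2 fun z h h' =>
        (hq1 i j hij (w 0) z (hu.1.trans huw.1) hw.1 (hu.2.trans h) (h'.trans hw.2)).2
      have h2 := sub_le_mul_sub_of_deriv_le (hdiff1 1 i j (u 1)) huw.1 fun z h h' =>
        (hq2 i j hij z (u 1) (hu.1.trans h) (h'.trans hw.1) hu.2 (huw.2.trans hw.2)).2
      linarith
  have hlpos : ∀ a i j, M.IsInterior i j → 0 ≤ M.lC (ε a) (v a) i j := fun a i j h =>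
    (Mesh.lC_pos (hε a) (hv a i j h.isMeshPt)).le
  have hrpos : ∀ a, 0 ≤ M.rC (ε a) := fun a => (Mesh.rC_pos (hε a)).le
  have key : ∀ n, (∀ a i j, M.IsMeshPt i j → Uhat a i j ≤ UlJ n a i j ∧
      UlJ n a i j ≤ UlGS n a i j ∧ UlGS n a i j ≤ UbGS n a i j ∧
      UbGS n a i j ≤ UbJ n a i j ∧ UbJ n a i j ≤ Utilde a i j) ∧
      (∀ a i j, M.IsMeshPt i j → UlJ n a i j ≤ UlJ (n + 1) a i j) ∧
      ∀ a i j, M.IsMeshPt i j → UbJ (n + 1) a i j ≤ UbJ n a i j := by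
    intro n
    induction n with
    | zero =>
      refine ⟨fun a i j h => ?_, fun a => ?_, fun a => ?_⟩
      · simp [hUbJ0, hUlJ0, hUbGS0, hUlGS0, hord a i j h]
      · refine Mesh.jacobi_comparison (hε a) (hv a) (hc a) (fun i j h => ?_) fun i j h => ?_
        · have h1 := hloJstep 1 le_rfl a i j h
          have h2 := hlower a i j h
          simp only [Nat.sub_self, Mesh.discL, zero_add, hUlJ0] at h1 h2 ⊢
          linarith
        · rw [hUlJ0, hloJbd _ le_add_self a i j h]
          exact (hbd a i j h).1
      · refine Mesh.jacobi_comparison (hε a) (hv a) (hc a) (fun i j h => ?_) fun i j h => ?_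
        · have h1 := hubJstep 1 le_rfl a i j h
          have h2 := hupper a i j h
          simp only [Nat.sub_self, Mesh.discL, zero_add, hUbJ0] at h1 h2 ⊢
          linarith
        · rw [hUbJ0, hubJbd _ le_add_self a i j h]
          exact (hbd a i j h).2
    | succ n ih =>
      obtain ⟨hchain, hlJ, hbJ⟩ := ih
      have hlo : ∀ a i j, M.IsMeshPt i j → UlJ (n + 1) a i j ≤ UlGS (n + 1) a i j := by
        intro a
        refine Mesh.gaussSeidel_comparison (hε a) (hv a) (hc a) (fun i j h => ?_) fun i j h => ?_
        · have h1 := hloJstep (n + 1) le_add_self a i j h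
          have h2 := hloGSstep (n + 1) le_add_self a i j h
          simp only [Nat.add_sub_cancel] at h1 h2
          obtain ⟨hw, he, -, -⟩ := h.neighbours
          have h3 := mul_le_mul_of_nonneg_left (hlJ a _ _ hw) (hlpos a i j h)
          have h4 := mul_le_mul_of_nonneg_left (hchain a _ _ he).2.1 (hrpos a)
          have h5 := hF i j h.isMeshPt (fun a => UlJ n a i j) (fun a => UlGS n a i j)
            (fun a => (hchain a i j h.isMeshPt).1) (fun a => (hchain a i j h.isMeshPt).2.1)
            (fun a => by have := hchain a i j h.isMeshPt; linarith) a
          linarith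
        · rw [hloJbd _ le_add_self a i j h, hloGSbd _ le_add_self a i j h]
      have hmid : ∀ a i j, M.IsMeshPt i j → UlGS (n + 1) a i j ≤ UbGS (n + 1) a i j := by
        intro a
        refine Mesh.gaussSeidel_comparison (hε a) (hv a) (hc a) (fun i j h => ?_) fun i j h => ?_
        · have h1 := hloGSstep (n + 1) le_add_self a i j h
          have h2 := hubGSstep (n + 1) le_add_self a i j h
          simp only [Nat.add_sub_cancel] at h1 h2
          have h4 := mul_le_mul_of_nonneg_left (hchain a _ _ h.neighbours.2.1).2.2.1 (hrpos a)
          have h5 := hF i j h.isMeshPt (fun a => UlGS n a i j) (fun a => UbGS n a i j)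
            (fun a => by have := hchain a i j h.isMeshPt; linarith)
            (fun a => (hchain a i j h.isMeshPt).2.2.1)
            (fun a => by have := hchain a i j h.isMeshPt; linarith) a
          linarith
        · rw [hloGSbd _ le_add_self a i j h, hubGSbd _ le_add_self a i j h]
      have hup : ∀ a i j, M.IsMeshPt i j → UbGS (n + 1) a i j ≤ UbJ (n + 1) a i j := by
        intro a
        refine Mesh.gaussSeidel_comparison (hε a) (hv a) (hc a) (fun i j h => ?_) fun i j h => ?_
        · have h1 := hubJstep (n + 1) le_add_self a i j h
          have h2 := hubGSstep (n + 1) le_add_self a i j h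
          simp only [Nat.add_sub_cancel] at h1 h2
          obtain ⟨hw, he, -, -⟩ := h.neighbours
          have h3 := mul_le_mul_of_nonneg_left (hbJ a _ _ hw) (hlpos a i j h)
          have h4 := mul_le_mul_of_nonneg_left (hchain a _ _ he).2.2.2.1 (hrpos a)
          have h5 := hF i j h.isMeshPt (fun a => UbGS n a i j) (fun a => UbJ n a i j)
            (fun a => by have := hchain a i j h.isMeshPt; linarith)
            (fun a => (hchain a i j h.isMeshPt).2.2.2.1)
            (fun a => (hchain a i j h.isMeshPt).2.2.2.2) a
          linarith
        · rw [hubJbd _ le_add_self a i j h, hubGSbd _ le_add_self a i j h]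
      have hchain' : ∀ a i j, M.IsMeshPt i j → Uhat a i j ≤ UlJ (n + 1) a i j ∧
          UlJ (n + 1) a i j ≤ UlGS (n + 1) a i j ∧ UlGS (n + 1) a i j ≤ UbGS (n + 1) a i j ∧
          UbGS (n + 1) a i j ≤ UbJ (n + 1) a i j ∧ UbJ (n + 1) a i j ≤ Utilde a i j :=
        fun a i j h => ⟨(hchain a i j h).1.trans (hlJ a i j h), hlo a i j h, hmid a i j h,
          hup a i j h, (hbJ a i j h).trans (hchain a i j h).2.2.2.2⟩
      refine ⟨hchain', fun a => ?_, fun a => ?_⟩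
      · refine Mesh.jacobi_comparison (hε a) (hv a) (hc a) (fun i j h => ?_) fun i j h => ?_
        · have h1 := hloJstep (n + 1) le_add_self a i j h
          have h2 := hloJstep (n + 1 + 1) le_add_self a i j h
          simp only [Nat.add_sub_cancel] at h1 h2
          obtain ⟨hw, he, -, -⟩ := h.neighbours
          have h3 := mul_le_mul_of_nonneg_left (hlJ a _ _ hw) (hlpos a i j h)
          have h4 := mul_le_mul_of_nonneg_left (hlJ a _ _ he) (hrpos a)
          have h5 := hF i j h.isMeshPt (fun a => UlJ n a i j) (fun a => UlJ (n + 1) a i j)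
            (fun a => (hchain a i j h.isMeshPt).1) (fun a => hlJ a i j h.isMeshPt)
            (fun a => by have := hchain' a i j h.isMeshPt; linarith) a
          linarith
        · rw [hloJbd _ le_add_self a i j h, hloJbd _ le_add_self a i j h]
      · refine Mesh.jacobi_comparison (hε a) (hv a) (hc a) (fun i j h => ?_) fun i j h => ?_
        · have h1 := hubJstep (n + 1) le_add_self a i j h
          have h2 := hubJstep (n + 1 + 1) le_add_self a i j h
          simp only [Nat.add_sub_cancel] at h1 h2
          obtain ⟨hw, he, -, -⟩ := h.neighbours
          have h3 := mul_le_mul_of_nonneg_left (hbJ a _ _ hw) (hlpos a i j h)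
          have h4 := mul_le_mul_of_nonneg_left (hbJ a _ _ he) (hrpos a)
          have h5 := hF i j h.isMeshPt (fun a => UbJ (n + 1) a i j) (fun a => UbJ n a i j)
            (fun a => by have := hchain' a i j h.isMeshPt; linarith)
            (fun a => hbJ a i j h.isMeshPt) (fun a => (hchain a i j h.isMeshPt).2.2.2.2) a
          linarith
        · rw [hubJbd _ le_add_self a i j h, hubJbd _ le_add_self a i j h]
  intro n a i j h
  have := (key n).1 a i j h
  exact ⟨this.2.1, this.2.2.1, this.2.2.2.1⟩
end

section
/- Assume f_α(i,j,0,0) ≤ 0 for all interior points, g_α(i,j) ≥ 0 at all boundary points, and that there exist constants M_α > 0 such that f_α(i,j,u₁,u₂) ≥ −M_α whenever u₁ ≥ 0 and u₂ ≥ 0, for α = 1,2. Let Û = (0,0) be the identically zero mesh vector function, and let Ũ = (Ũ₁,Ũ₂) be the mesh vector function satisfying the linear problems 𝓛_α Ũ_α(i,j) = M_α at interior points and Ũ_α(i,j) = g_α(i,j) at boundary points. Then Ũ and Û are ordered upper and lower solutions of the nonlinear difference scheme; in particular Û_α(i,j) ≤ Ũ_α(i,j) at every mesh point for α = 1,2.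 -/
open BlockMonotone

namespace BlockMonotone.Mesh

/-- At an interior minimum over the mesh the discrete operator is nonpositive. -/
theorem discL_nonpos_of_isMin (M : Mesh) {ε : ℝ} (hε : 0 ≤ ε) {v U : ℕ → ℕ → ℝ} {i j : ℕ}
    (hv : 0 ≤ v i j) (hij : M.IsInterior i j)
    (hmin : ∀ i' j', M.IsMeshPt i' j' → U i j ≤ U i' j') :
    M.discL ε v U i j ≤ 0 := by
  obtain ⟨hi, hi', hj, hj'⟩ := hij
  have hx : 0 ≤ M.hx := by unfold hx; positivity
  have hy : 0 ≤ M.hy := by unfold hy; positivity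
  have hl : 0 ≤ M.lC ε v i j := by unfold lC; positivity
  have hr : 0 ≤ M.rC ε := by unfold rC; positivity
  have hb : 0 ≤ M.bC ε v i j := by unfold bC; positivity
  have ht : 0 ≤ M.tC ε := by unfold tC; positivity
  have hleft := mul_le_mul_of_nonneg_left (hmin (i - 1) j ⟨by lia, by lia⟩) hl
  have hright := mul_le_mul_of_nonneg_left (hmin (i + 1) j ⟨by lia, by lia⟩) hr
  have hbottom := mul_le_mul_of_nonneg_left (hmin i (j - 1) ⟨by lia, by lia⟩) hb
  have htop := mul_le_mul_of_nonneg_left (hmin i (j + 1) ⟨by lia, by lia⟩) ht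
  unfold discL dC
  linarith

/-- Discrete minimum principle: a mesh function with positive image under the discrete operator
and nonnegative boundary values is nonnegative. -/
theorem nonneg_of_discL_pos (M : Mesh) {ε : ℝ} (hε : 0 ≤ ε) {v U : ℕ → ℕ → ℝ}
    (hv : ∀ i j, M.IsInterior i j → 0 ≤ v i j)
    (hL : ∀ i j, M.IsInterior i j → 0 < M.discL ε v U i j)
    (hU : ∀ i j, M.IsBoundary i j → 0 ≤ U i j) {i j : ℕ} (hij : M.IsMeshPt i j) :
    0 ≤ U i j := by
  obtain ⟨p, hp, hmin⟩ := Finset.exists_min_image (Finset.Iic M.Nx ×ˢ Finset.Iic M.Ny)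
    (fun q => U q.1 q.2) ⟨(0, 0), by simp⟩
  simp only [Finset.mem_product, Finset.mem_Iic, Prod.forall] at hp hmin
  have hpb : M.IsBoundary p.1 p.2 := ⟨hp, fun hpi =>
    (hL _ _ hpi).not_ge (M.discL_nonpos_of_isMin hε (hv _ _ hpi) hpi hmin)⟩
  exact (hU _ _ hpb).trans (hmin i j hij)

end BlockMonotone.Mesh

/-- Construction of initial ordered upper and lower solutions for bounded reaction
functions: Û = 0 and Ũ the solution of the linear problem 𝓛_α Ũ_α = M_α. -/
theorem initial_solutions_bounded (M : Mesh)
    (ε : Fin 2 → ℝ) (hε : ∀ a, 0 < ε a)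
    (v : Fin 2 → ℕ → ℕ → ℝ) (hv : ∀ a i j, M.IsMeshPt i j → 0 ≤ v a i j)
    (f : Fin 2 → ℕ → ℕ → ℝ → ℝ → ℝ) (g : Fin 2 → ℕ → ℕ → ℝ)
    (hf0 : ∀ a i j, M.IsInterior i j → f a i j 0 0 ≤ 0)
    (hg : ∀ a i j, M.IsBoundary i j → 0 ≤ g a i j)
    (Mc : Fin 2 → ℝ) (hMc : ∀ a, 0 < Mc a)
    (hfM : ∀ a i j, M.IsInterior i j → ∀ u₁ u₂ : ℝ, 0 ≤ u₁ → 0 ≤ u₂ →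
      -(Mc a) ≤ f a i j u₁ u₂)
    (Utilde : Fin 2 → ℕ → ℕ → ℝ)
    (hlin : ∀ a i j, M.IsInterior i j → M.discL (ε a) (v a) (Utilde a) i j = Mc a)
    (hlinbd : ∀ a i j, M.IsBoundary i j → Utilde a i j = g a i j) :
    (∀ a i j, M.IsMeshPt i j → (0 : ℝ) ≤ Utilde a i j)
    ∧ (∀ a i j, M.IsInterior i j →
        0 ≤ M.discL (ε a) (v a) (Utilde a) i j + f a i j (Utilde 0 i j) (Utilde 1 i j))
    ∧ (∀ a i j, M.IsInterior i j →
        M.discL (ε a) (v a) (fun _ _ => (0 : ℝ)) i j + f a i j 0 0 ≤ 0)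
    ∧ (∀ a i j, M.IsBoundary i j → (0 : ℝ) ≤ g a i j ∧ g a i j ≤ Utilde a i j) := by
  have hnonneg : ∀ a i j, M.IsMeshPt i j → (0 : ℝ) ≤ Utilde a i j := fun a i j =>
    M.nonneg_of_discL_pos (hε a).le
      (fun i j h => hv a i j ⟨h.2.1.trans (Nat.sub_le _ _), h.2.2.2.trans (Nat.sub_le _ _)⟩)
      (fun i j h => (hMc a).trans_eq (hlin a i j h).symm)
      (fun i j h => (hg a i j h).trans_eq (hlinbd a i j h).symm)
  refine ⟨hnonneg, fun a i j h => ?_, fun a i j h => ?_,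
    fun a i j h => ⟨hg a i j h, (hlinbd a i j h).ge⟩⟩
  · have hm : M.IsMeshPt i j :=
      ⟨h.2.1.trans (Nat.sub_le _ _), h.2.2.2.trans (Nat.sub_le _ _)⟩
    linarith [hlin a i j h, hfM a i j h _ _ (hnonneg 0 i j hm) (hnonneg 1 i j hm)]
  · simpa [Mesh.discL] using hf0 a i j h
end
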